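/- arXiv:1612.08461 — 11 statements merged into one kernel-verified Lean document; each statement's English description precedes it below -/
import Mathlib

section
/- Let α ∈ (0,1] and C ≥ 0 be reals. Let (γ_t)_{t≥0} be a real sequence with 0 < γ_t ≤ 1 for all t and (1 − αγ_{t+1})/γ_{t+1}² ≤ 1/γ_t² for all t ≥ 0. Let (h_t)_{t≥0} be a sequence of nonnegative reals satisfying h_{t+1} ≤ (1 − αγ_t) h_t + γ_t² C / 2 for all t ≥ 0. Then for every t ≥ 1, h_t ≤ ((1 − αγ_0)/γ_0²) · γ_{t−1}² · h_0 + (t C / 2) · γ_{t−1}². -/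
/-- Primal convergence (Theorem 1) as a deterministic recurrence: given step sizes
`γ_t ∈ (0,1]` satisfying the compatibility condition, and nonnegative `h_t` with
`h_{t+1} ≤ (1 - αγ_t) h_t + γ_t² C/2`, we get
`h_t ≤ ((1 - αγ_0)/γ_0²) γ_{t-1}² h_0 + (tC/2) γ_{t-1}²` for all `t ≥ 1`. -/
theorem stmt_5 (α C : ℝ) (hα0 : 0 < α) (hα1 : α ≤ 1) (hC : 0 ≤ C)
    (γ h : ℕ → ℝ) (hγ0 : ∀ t, 0 < γ t) (hγ1 : ∀ t, γ t ≤ 1)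
    (hcompat : ∀ t, (1 - α * γ (t + 1)) / (γ (t + 1)) ^ 2 ≤ 1 / (γ t) ^ 2)
    (hh : ∀ t, 0 ≤ h t)
    (hrec : ∀ t, h (t + 1) ≤ (1 - α * γ t) * h t + (γ t) ^ 2 * C / 2) :
    ∀ t : ℕ, 1 ≤ t →
      h t ≤ (1 - α * γ 0) / (γ 0) ^ 2 * (γ (t - 1)) ^ 2 * h 0
        + (t : ℝ) * C / 2 * (γ (t - 1)) ^ 2 := by
  have key : ∀ n : ℕ, h (n + 1) / γ n ^ 2 ≤
      (1 - α * γ 0) / γ 0 ^ 2 * h 0 + ((n + 1 : ℕ) : ℝ) * C / 2 := by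
    intro n
    induction n with
    | zero =>
      calc h (0 + 1) / γ 0 ^ 2
          ≤ ((1 - α * γ 0) * h 0 + γ 0 ^ 2 * C / 2) / γ 0 ^ 2 := by
            gcongr
            exact hrec 0
        _ = _ := by
            have hne := (hγ0 0).ne'
            push_cast
            field_simp
    | succ n ih =>
      calc h (n + 1 + 1) / γ (n + 1) ^ 2
          ≤ ((1 - α * γ (n + 1)) * h (n + 1) + γ (n + 1) ^ 2 * C / 2) / γ (n + 1) ^ 2 := by
            gcongr
            exact hrec (n + 1)
        _ = (1 - α * γ (n + 1)) / γ (n + 1) ^ 2 * h (n + 1) + C / 2 := by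
            have hne := (hγ0 (n + 1)).ne'
            field_simp
        _ ≤ 1 / γ n ^ 2 * h (n + 1) + C / 2 := by
            gcongr ?_ * _ + _
            · exact hh (n + 1)
            · exact hcompat n
        _ = h (n + 1) / γ n ^ 2 + C / 2 := by ring
        _ ≤ _ := by
            push_cast at ih ⊢
            linarith
  intro t ht
  obtain ⟨n, rfl⟩ := Nat.exists_eq_add_of_le' ht
  have hn := (div_le_iff₀ (pow_pos (hγ0 n) 2)).mp (key n)
  rw [Nat.add_sub_cancel]
  linarith
end

section
/- Let α ∈ (0,1] and C ≥ 0 be reals. Let (γ_t)_{t≥0} be a nonincreasing real sequence with 0 < γ_t ≤ 1 for all t. Let (h_t)_{t≥0} and (g_t)_{t≥0} be sequences of nonnegative reals satisfying α γ_k g_k ≤ h_k − h_{k+1} + γ_k² C / 2 for all k ≥ 0. Then for every t ≥ 1 and every integer K with 1 ≤ K ≤ t, min_{0 ≤ k ≤ t} g_k ≤ h_K / (α (t − K + 1) γ_t) + C γ_K² / (2 α γ_t). -/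
/-- Telescoping: if `a ≤ u k - u (k + 1) + b` on the `n` indices from `K` on, then
`n * a ≤ u K - u (K + n) + n * b`. -/
theorem nat_mul_le_sub_add_of_le_sub_succ_add {u : ℕ → ℝ} {a b : ℝ} {K n : ℕ}
    (hu : ∀ k, K ≤ k → k < K + n → a ≤ u k - u (k + 1) + b) :
    (n : ℝ) * a ≤ u K - u (K + n) + n * b := by
  induction n with
  | zero => simp
  | succ n ih =>
    have hn := ih fun k hk hkn => hu k hk (by omega)
    have hlast := hu (K + n) (by omega) (by omega)
    rw [← Nat.add_assoc]
    push_cast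
    linarith

/-- Primal-dual convergence (Theorem 2) as a deterministic recurrence: for a
nonincreasing step-size sequence `γ_t ∈ (0,1]` and nonnegative sequences `h, g`
with `α γ_k g_k ≤ h_k - h_{k+1} + γ_k² C/2`, for all `t ≥ 1` and `1 ≤ K ≤ t`,
`min_{0 ≤ k ≤ t} g_k ≤ h_K/(α(t-K+1)γ_t) + C γ_K²/(2αγ_t)`. -/
theorem stmt_6 (α C : ℝ) (hα0 : 0 < α) (hα1 : α ≤ 1) (hC : 0 ≤ C)
    (γ h g : ℕ → ℝ) (hγ0 : ∀ t, 0 < γ t) (hγ1 : ∀ t, γ t ≤ 1) (hmono : Antitone γ)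
    (hh : ∀ t, 0 ≤ h t) (hg : ∀ t, 0 ≤ g t)
    (hrec : ∀ k, α * γ k * g k ≤ h k - h (k + 1) + (γ k) ^ 2 * C / 2) :
    ∀ t : ℕ, 1 ≤ t → ∀ K : ℕ, 1 ≤ K → K ≤ t →
      (Finset.range (t + 1)).inf' (Finset.nonempty_range_iff.mpr (Nat.succ_ne_zero t)) g
        ≤ h K / (α * ((t : ℝ) - (K : ℝ) + 1) * γ t) + C * (γ K) ^ 2 / (2 * α * γ t) := by
  intro t _ K _ hKt
  set m := (Finset.range (t + 1)).inf' (Finset.nonempty_range_iff.mpr (Nat.succ_ne_zero t)) g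
  have hm0 : 0 ≤ m := Finset.le_inf' _ _ fun k _ => hg k
  have hstep : ∀ k, K ≤ k → k < K + (t + 1 - K) →
      α * γ t * m ≤ h k - h (k + 1) + (γ K) ^ 2 * C / 2 := by
    intro k hKk hk
    have hmk : m ≤ g k := Finset.inf'_le _ (Finset.mem_range.mpr (by omega))
    have hγt : γ t ≤ γ k := hmono (by omega)
    have hγK : γ k ≤ γ K := hmono hKk
    have hγk := (hγ0 k).le
    calc α * γ t * m ≤ α * γ k * g k := by gcongr
      _ ≤ h k - h (k + 1) + (γ k) ^ 2 * C / 2 := hrec k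
      _ ≤ h k - h (k + 1) + (γ K) ^ 2 * C / 2 := by gcongr
  have hsum := nat_mul_le_sub_add_of_le_sub_succ_add hstep
  have hcast : ((t + 1 - K : ℕ) : ℝ) = (t : ℝ) - K + 1 := by
    rw [Nat.cast_sub (by omega)]
    push_cast
    ring
  rw [hcast] at hsum
  have hn : 0 < (t : ℝ) - K + 1 := by
    have : (K : ℝ) ≤ t := by exact_mod_cast hKt
    linarith
  have hγt := hγ0 t
  have hend := hh (K + (t + 1 - K))
  have hsplit : h K / (α * ((t : ℝ) - K + 1) * γ t) + C * (γ K) ^ 2 / (2 * α * γ t)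
      = (h K + ((t : ℝ) - K + 1) * ((γ K) ^ 2 * C / 2)) / (α * ((t : ℝ) - K + 1) * γ t) := by
    field_simp
  rw [hsplit, le_div_iff₀ (by positivity)]
  linarith
end

section
/- Let α ∈ (0,1], q ∈ (0, α], and ρ ∈ (1/2, 1] be reals, and define γ_t := 2/(q t^ρ + 2) for integers t ≥ 0. Then for all t ≥ 0, (1 − αγ_{t+1})/γ_{t+1}² ≤ 1/γ_t². -/
/-- Lemma 2: the step sizes `γ_t = 2/(q t^ρ + 2)` with `0 < q ≤ α ≤ 1` and
`ρ ∈ (1/2, 1]` satisfy the compatibility condition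
`(1 - α γ_{t+1})/γ_{t+1}² ≤ 1/γ_t²`. -/
theorem stmt_7 (α q ρ : ℝ) (hα0 : 0 < α) (hα1 : α ≤ 1) (hq0 : 0 < q) (hqα : q ≤ α)
    (hρ0 : 1 / 2 < ρ) (hρ1 : ρ ≤ 1)
    (γ : ℕ → ℝ) (hγ : ∀ t : ℕ, γ t = 2 / (q * (t : ℝ) ^ ρ + 2)) :
    ∀ t : ℕ, (1 - α * γ (t + 1)) / (γ (t + 1)) ^ 2 ≤ 1 / (γ t) ^ 2 := by
  intro t
  have hsub : ((t + 1 : ℕ) : ℝ) ^ ρ ≤ (t : ℝ) ^ ρ + 1 := by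
    have h := Real.rpow_add_le_add_rpow t.cast_nonneg zero_le_one (by linarith) hρ1
    simpa using h
  have ha : 0 ≤ (t : ℝ) ^ ρ := by positivity
  have hb : 0 ≤ ((t + 1 : ℕ) : ℝ) ^ ρ := by positivity
  rw [hγ, hγ]
  generalize (t : ℝ) ^ ρ = a at *
  generalize ((t + 1 : ℕ) : ℝ) ^ ρ = b at *
  have hstep : q * b + 2 - α ≤ q * a + 2 := by
    linarith [mul_le_mul_of_nonneg_left hsub hq0.le]
  have hpos : 0 ≤ q * b + 2 - α := by
    linarith [mul_nonneg hq0.le hb]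
  have hl : (1 - α * (2 / (q * b + 2))) / (2 / (q * b + 2)) ^ 2
      = ((q * b + 2 - α) ^ 2 - α ^ 2) / 4 := by
    have : q * b + 2 ≠ 0 := by positivity
    field_simp
    ring
  have hr : 1 / (2 / (q * a + 2)) ^ 2 = (q * a + 2) ^ 2 / 4 := by
    rw [div_pow, one_div_div]
    norm_num
  rw [hl, hr]
  linarith [pow_le_pow_left₀ hpos hstep 2, sq_nonneg α]
end

section
/- Let α ∈ (0,1], q ∈ (0, α], ρ ∈ (1/2, 1], and C ≥ 0 be reals, and define γ_t := 2/(q t^ρ + 2) for integers t ≥ 0. Let (h_t)_{t≥0} be a sequence of nonnegative reals satisfying h_{t+1} ≤ (1 − αγ_t) h_t + γ_t² C / 2 for all t ≥ 0. Then for every t ≥ 1, h_t ≤ 4(1 − α) h_0 / (q(t−1)^ρ + 2)² + 2 t C / (q(t−1)^ρ + 2)². -/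
theorem rpow_succ_le_rpow_add_one {ρ : ℝ} (n : ℕ) (hρ0 : 0 ≤ ρ) (hρ1 : ρ ≤ 1) :
    ((n + 1 : ℕ) : ℝ) ^ ρ ≤ (n : ℝ) ^ ρ + 1 := by
  simpa using Real.rpow_add_le_add_rpow n.cast_nonneg zero_le_one hρ0 hρ1

theorem sq_sub_two_mul_le_sq {α x y : ℝ} (hy : 0 ≤ y) (hxy : y ≤ x + α) :
    y ^ 2 - 2 * α * y ≤ x ^ 2 := by
  nlinarith [sq_nonneg (x - y)]

/-- Primal bound of Corollary 1 as a deterministic recurrence: with step sizes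
`γ_t = 2/(q t^ρ + 2)` and nonnegative `h_t` obeying
`h_{t+1} ≤ (1 - αγ_t) h_t + γ_t² C/2`, one has for all `t ≥ 1`
`h_t ≤ 4(1-α)h_0/(q(t-1)^ρ + 2)² + 2tC/(q(t-1)^ρ + 2)²`. -/
theorem stmt_8 (α q ρ C : ℝ) (hα0 : 0 < α) (hα1 : α ≤ 1) (hq0 : 0 < q) (hqα : q ≤ α)
    (hρ0 : 1 / 2 < ρ) (hρ1 : ρ ≤ 1) (hC : 0 ≤ C)
    (γ : ℕ → ℝ) (hγ : ∀ t : ℕ, γ t = 2 / (q * (t : ℝ) ^ ρ + 2))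
    (h : ℕ → ℝ) (hh : ∀ t, 0 ≤ h t)
    (hrec : ∀ t, h (t + 1) ≤ (1 - α * γ t) * h t + (γ t) ^ 2 * C / 2) :
    ∀ t : ℕ, 1 ≤ t →
      h t ≤ 4 * (1 - α) * h 0 / (q * ((t - 1 : ℕ) : ℝ) ^ ρ + 2) ^ 2
        + 2 * (t : ℝ) * C / (q * ((t - 1 : ℕ) : ℝ) ^ ρ + 2) ^ 2 := by
  have hD : ∀ t : ℕ, 0 < q * (t : ℝ) ^ ρ + 2 := fun t => by positivity
  have hstep : ∀ t : ℕ, (q * (t : ℝ) ^ ρ + 2) ^ 2 * h (t + 1) ≤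
      ((q * (t : ℝ) ^ ρ + 2) ^ 2 - 2 * α * (q * (t : ℝ) ^ ρ + 2)) * h t + 2 * C := by
    intro t
    have hDt := hD t
    have hr := hrec t
    rw [hγ] at hr
    generalize q * (t : ℝ) ^ ρ + 2 = D at hDt hr ⊢
    calc D ^ 2 * h (t + 1)
        ≤ D ^ 2 * ((1 - α * (2 / D)) * h t + (2 / D) ^ 2 * C / 2) := by gcongr
      _ = (D ^ 2 - 2 * α * D) * h t + 2 * C := by field_simp
  have hscaled : ∀ n : ℕ, (q * (n : ℝ) ^ ρ + 2) ^ 2 * h (n + 1) ≤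
      4 * (1 - α) * h 0 + 2 * ((n : ℝ) + 1) * C := by
    intro n
    induction n with
    | zero =>
      have h0 := hstep 0
      have hz : (0 : ℝ) ^ ρ = 0 := Real.zero_rpow (by linarith)
      simp only [Nat.cast_zero, hz] at h0 ⊢
      linarith
    | succ n ih =>
      have hn := hstep (n + 1)
      have hpow := rpow_succ_le_rpow_add_one n (by linarith) hρ1
      have hcoeff := sq_sub_two_mul_le_sq (α := α) (x := q * (n : ℝ) ^ ρ + 2)
        (hD (n + 1)).le (by linarith [mul_le_mul_of_nonneg_left hpow hq0.le])
      have := mul_le_mul_of_nonneg_right hcoeff (hh (n + 1))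
      push_cast at hn this ⊢
      linarith
  intro t ht
  obtain ⟨n, rfl⟩ := Nat.exists_eq_add_of_le' ht
  rw [← add_div, le_div_iff₀ (pow_pos (hD _) 2), mul_comm]
  simpa using hscaled n
end

section
/- Let α ∈ (0,1], q ∈ (0, α], ρ ∈ (1/2, 1], and C ≥ 0 be reals, and define γ_t := 2/(q t^ρ + 2) for integers t ≥ 0. Let (h_t)_{t≥0} and (g_t)_{t≥0} be sequences of nonnegative reals satisfying h_k ≤ g_k and α γ_k g_k ≤ h_k − h_{k+1} + γ_k² C / 2 for all k ≥ 0. Then for every t ≥ 1, min_{0 ≤ k ≤ t} g_k ≤ ((2ρ+1)^{2ρ+1} (q t^ρ + 2) / (α q² (2ρ)^{2ρ})) · ((t+1) C + 2(1−α) h_0) / t^{2ρ+1}. -/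
theorem natCast_succ_rpow_le {ρ : ℝ} (hρ0 : 0 ≤ ρ) (hρ1 : ρ ≤ 1) (k : ℕ) :
    ((k + 1 : ℕ) : ℝ) ^ ρ ≤ (k : ℝ) ^ ρ + 1 := by
  have := Real.rpow_add_le_add_rpow (Nat.cast_nonneg (α := ℝ) k) zero_le_one hρ0 hρ1
  simpa using this

/-- Clearing denominators in the descent inequality with step size `2 / s`. -/
theorem descent_clear_denom {α C s g h h' : ℝ} (hs : 0 < s)
    (H : α * (2 / s) * g ≤ h - h' + (2 / s) ^ 2 * C / 2) :
    2 * α * s * g ≤ s ^ 2 * (h - h') + 2 * C := by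
  have := mul_le_mul_of_nonneg_left H (sq_nonneg s)
  have e1 : s ^ 2 * (α * (2 / s) * g) = 2 * α * s * g := by field_simp
  have e2 : s ^ 2 * (h - h' + (2 / s) ^ 2 * C / 2) = s ^ 2 * (h - h') + 2 * C := by
    field_simp
  linarith

theorem primal_bound {α q ρ C : ℝ} (hα0 : 0 < α) (hα1 : α ≤ 1) (hq0 : 0 < q) (hqα : q ≤ α)
    (hρ0 : 0 < ρ) (hρ1 : ρ ≤ 1) {h g : ℕ → ℝ} (hh : ∀ t, 0 ≤ h t) (hhg : ∀ k, h k ≤ g k)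
    (hrec : ∀ k : ℕ, 2 * α * (q * (k : ℝ) ^ ρ + 2) * g k ≤
      (q * (k : ℝ) ^ ρ + 2) ^ 2 * (h k - h (k + 1)) + 2 * C) (k : ℕ) :
    (q * (k : ℝ) ^ ρ + 2) ^ 2 * h (k + 1) ≤ 2 * ((k + 1) * C + 2 * (1 - α) * h 0) := by
  induction k with
  | zero =>
    have h0 := hrec 0
    simp only [Nat.cast_zero, Real.zero_rpow hρ0.ne'] at h0 ⊢
    have := mul_le_mul_of_nonneg_left (hhg 0) hα0.le
    linarith
  | succ k ih =>
    have hk := hrec (k + 1)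
    have hsub := natCast_succ_rpow_le hρ0.le hρ1 k
    have hone : (1 : ℝ) ≤ ((k + 1 : ℕ) : ℝ) ^ ρ :=
      Real.one_le_rpow (by exact_mod_cast Nat.succ_le_succ k.zero_le) hρ0.le
    push_cast at hk hsub hone ⊢
    set u : ℝ := ((k : ℝ) + 1) ^ ρ
    set v : ℝ := (k : ℝ) ^ ρ
    have hs : 0 < q * u + 2 := by positivity
    have hgap : 2 * q * (q * u + 2) * h (k + 1) ≤ 2 * α * (q * u + 2) * g (k + 1) := by
      have := hh (k + 1)
      have := hhg (k + 1)
      gcongr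
    have hsq : (q * u + 2 - q) ^ 2 ≤ (q * v + 2) ^ 2 := by
      apply pow_le_pow_left₀ <;> nlinarith
    have := mul_le_mul_of_nonneg_right hsq (hh (k + 1))
    have := mul_nonneg (sq_nonneg q) (hh (k + 1))
    linarith

theorem mul_le_sub_add_mul_of_forall_le {h : ℕ → ℝ} {c d : ℝ} (a n : ℕ)
    (H : ∀ k, a ≤ k → k < a + n → c ≤ h k - h (k + 1) + d) :
    n * c ≤ h a - h (a + n) + n * d := by
  induction n with
  | zero => simp
  | succ n ih =>
    have h1 := ih fun k hk hk' => H k hk (by omega)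
    have h2 := H (a + n) (by omega) (by omega)
    rw [← add_assoc]
    push_cast
    linarith

/-- Duality-gap bound of Corollary 1 as a deterministic recurrence: with step sizes
`γ_t = 2/(q t^ρ + 2)` and nonnegative sequences `h, g` satisfying `h_k ≤ g_k` and
`α γ_k g_k ≤ h_k - h_{k+1} + γ_k² C/2`, for all `t ≥ 1`,
`min_{0≤k≤t} g_k ≤ ((2ρ+1)^{2ρ+1}(q t^ρ + 2)/(α q² (2ρ)^{2ρ})) · ((t+1)C + 2(1-α)h_0)/t^{2ρ+1}`. -/
theorem stmt_9 (α q ρ C : ℝ) (hα0 : 0 < α) (hα1 : α ≤ 1) (hq0 : 0 < q) (hqα : q ≤ α)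
    (hρ0 : 1 / 2 < ρ) (hρ1 : ρ ≤ 1) (hC : 0 ≤ C)
    (γ : ℕ → ℝ) (hγ : ∀ t : ℕ, γ t = 2 / (q * (t : ℝ) ^ ρ + 2))
    (h g : ℕ → ℝ) (hh : ∀ t, 0 ≤ h t) (hg : ∀ t, 0 ≤ g t)
    (hhg : ∀ k, h k ≤ g k)
    (hrec : ∀ k, α * γ k * g k ≤ h k - h (k + 1) + (γ k) ^ 2 * C / 2) :
    ∀ t : ℕ, 1 ≤ t →
      (Finset.range (t + 1)).inf' (Finset.nonempty_range_iff.mpr (Nat.succ_ne_zero t)) g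
        ≤ (2 * ρ + 1) ^ (2 * ρ + 1) * (q * (t : ℝ) ^ ρ + 2) / (α * q ^ 2 * (2 * ρ) ^ (2 * ρ))
          * (((t : ℝ) + 1) * C + 2 * (1 - α) * h 0) / (t : ℝ) ^ (2 * ρ + 1) := by
  intro t ht
  set m := (Finset.range (t + 1)).inf' (Finset.nonempty_range_iff.mpr (Nat.succ_ne_zero t)) g
  have hmg : ∀ k ≤ t, m ≤ g k := fun k hk =>
    Finset.inf'_le _ (Finset.mem_range.mpr (by omega))
  have hm0 : 0 ≤ m := Finset.le_inf' _ _ fun k _ => hg k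
  have hρ : 0 < ρ := by linarith
  have ht0 : (0 : ℝ) < t := by exact_mod_cast ht
  have hs : ∀ k : ℕ, 0 < q * (k : ℝ) ^ ρ + 2 := fun k => by positivity
  simp only [hγ] at hrec
  obtain ⟨μ, hμ⟩ : ∃ μ, μ = 2 * ρ / (2 * ρ + 1) := ⟨_, rfl⟩
  have hμ0 : 0 < μ := by rw [hμ]; positivity
  have hμ1 : 1 - μ = 1 / (2 * ρ + 1) := by rw [hμ]; field_simp; ring
  have hμ_lt : μ < 1 := by
    have : 0 < 1 / (2 * ρ + 1) := by positivity
    linarith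
  -- The averaging window is `[a, t]` with `a = ⌈μ t⌉`.
  obtain ⟨a, ha⟩ : ∃ a, a = ⌈μ * t⌉₊ := ⟨_, rfl⟩
  have hμt : 0 < μ * t := by positivity
  have hle_a : μ * t ≤ a := ha ▸ Nat.le_ceil _
  have ha_lt : (a : ℝ) < μ * t + 1 := ha ▸ Nat.ceil_lt_add_one hμt.le
  have ha_le : a ≤ t := by
    rw [ha]
    exact Nat.ceil_le.mpr (by nlinarith)
  have ha_pos : 0 < a := ha ▸ Nat.ceil_pos.mpr hμt
  obtain ⟨n, hn⟩ := Nat.exists_eq_add_of_le (ha_le.trans t.le_succ)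
  have hnR : (a : ℝ) + n = t + 1 := by exact_mod_cast hn.symm
  set x := (μ * t) ^ ρ with hx
  have hx0 : 0 < x := by positivity
  have hxk : ∀ k : ℕ, a ≤ k → x ≤ (k : ℝ) ^ ρ := fun k hk =>
    Real.rpow_le_rpow hμt.le (hle_a.trans (by exact_mod_cast hk)) hρ.le
  have hha : h a ≤ 2 * (a * C + 2 * (1 - α) * h 0) / (q * x) ^ 2 := by
    obtain ⟨b, rfl⟩ := Nat.exists_eq_add_of_le' ha_pos
    have hb := primal_bound hα0 hα1 hq0 hqα hρ hρ1 hh hhg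
      (fun k => descent_clear_denom (hs k) (hrec k)) b
    rw [le_div_iff₀ (by positivity)]
    have h1 := natCast_succ_rpow_le hρ.le hρ1 b
    have h2 := hxk _ le_rfl
    have h3 : q * x ≤ q * (b : ℝ) ^ ρ + 2 := by nlinarith
    have h4 : (q * x) ^ 2 ≤ (q * (b : ℝ) ^ ρ + 2) ^ 2 :=
      pow_le_pow_left₀ (by positivity) h3 2
    have := mul_le_mul_of_nonneg_right h4 (hh (b + 1))
    push_cast
    linarith
  have hsum := mul_le_sub_add_mul_of_forall_le (h := h)
    (c := α * (2 / (q * (t : ℝ) ^ ρ + 2)) * m) (d := 2 * C / (q * x) ^ 2) a n fun k hk hk' => by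
      have hkt : k ≤ t := by omega
      have h1 : α * (2 / (q * (t : ℝ) ^ ρ + 2)) * m ≤ α * (2 / (q * (k : ℝ) ^ ρ + 2)) * g k := by
        have := hmg k hkt
        gcongr
      have h2 : (2 / (q * (k : ℝ) ^ ρ + 2)) ^ 2 * C / 2 ≤ (2 / (q * x)) ^ 2 * C / 2 := by
        have : q * x ≤ q * (k : ℝ) ^ ρ + 2 := by nlinarith [hxk k hk]
        gcongr
      have h3 : (2 / (q * x)) ^ 2 * C / 2 = 2 * C / (q * x) ^ 2 := by ring
      linarith [hrec k]
  have hwin : (1 - μ) * t * (α * (2 / (q * (t : ℝ) ^ ρ + 2)) * m) ≤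
      2 * ((t + 1) * C + 2 * (1 - α) * h 0) / (q * x) ^ 2 := by
    have h1 : (1 - μ) * t * (α * (2 / (q * (t : ℝ) ^ ρ + 2)) * m) ≤
        n * (α * (2 / (q * (t : ℝ) ^ ρ + 2)) * m) := by
      gcongr
      linarith
    have h2 : 2 * (a * C + 2 * (1 - α) * h 0) / (q * x) ^ 2 + n * (2 * C / (q * x) ^ 2) =
        2 * ((t + 1) * C + 2 * (1 - α) * h 0) / (q * x) ^ 2 := by
      rw [← hnR]
      ring
    linarith [hh (a + n)]
  have hx2 : x ^ 2 = (2 * ρ) ^ (2 * ρ) / (2 * ρ + 1) ^ (2 * ρ) * (t : ℝ) ^ (2 * ρ) := by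
    rw [hx, ← Real.rpow_mul_natCast hμt.le, Nat.cast_ofNat, mul_comm ρ 2,
      Real.mul_rpow hμ0.le ht0.le, hμ, Real.div_rpow (by positivity) (by positivity)]
  rw [hμ1, mul_pow, hx2] at hwin
  rw [Real.rpow_add_one (by positivity), Real.rpow_add_one ht0.ne']
  have hst := hs t
  have hP : 0 < (2 * ρ + 1) ^ (2 * ρ) := by positivity
  have hQ : 0 < (2 * ρ) ^ (2 * ρ) := by positivity
  have hT : 0 < (t : ℝ) ^ (2 * ρ) := by positivity
  have hr : 0 < 2 * ρ + 1 := by positivity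
  generalize (2 * ρ + 1) ^ (2 * ρ) = P at *
  generalize (2 * ρ) ^ (2 * ρ) = Q at *
  generalize (t : ℝ) ^ (2 * ρ) = T at *
  generalize 2 * ρ + 1 = r at *
  generalize q * (t : ℝ) ^ ρ + 2 = s at *
  have key := mul_le_mul_of_nonneg_left hwin (show 0 ≤ r * s / (2 * α * t) by positivity)
  calc
    m = r * s / (2 * α * t) * (1 / r * t * (α * (2 / s) * m)) := by field_simp
    _ ≤ _ := key
    _ = _ := by field_simp
end

section
/- Let α ∈ (0,1] be real, and define the sequence (γ_t)_{t≥0} by γ_0 = 1 and γ_{t+1} = (√(α² γ_t⁴ + 4 γ_t²) − α γ_t²)/2. Then for all t ≥ 0: (i) 1/(α t + 1) ≤ γ_t ≤ 2/(α t + 2), and (ii) γ_{t+1} ≤ γ_t. -/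
/-- One step of the recursion adds between `α / 2` and `α` to the reciprocal of the step size. -/
theorem recursive_step_inv_bounds {α g h : ℝ} (hα : 0 < α) (hg : 0 < g)
    (hh : h = (Real.sqrt (α ^ 2 * g ^ 4 + 4 * g ^ 2) - α * g ^ 2) / 2) :
    0 < h ∧ g⁻¹ + α / 2 ≤ h⁻¹ ∧ h⁻¹ ≤ g⁻¹ + α := by
  have h_pos : 0 < h := by
    have : α * g ^ 2 < Real.sqrt (α ^ 2 * g ^ 4 + 4 * g ^ 2) :=
      Real.lt_sqrt_of_sq_lt (by nlinarith [sq_pos_of_pos hg])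
    linarith
  have h_quad : h ^ 2 + α * g ^ 2 * h = g ^ 2 := by
    have := Real.sq_sqrt (show 0 ≤ α ^ 2 * g ^ 4 + 4 * g ^ 2 by positivity)
    rw [hh]
    linear_combination this / 4
  have hu : 0 < g⁻¹ := inv_pos.2 hg
  have hv : 0 < h⁻¹ := inv_pos.2 h_pos
  have h_inv : (h⁻¹ - g⁻¹) * (h⁻¹ + g⁻¹) = α * h⁻¹ := by
    field_simp
    linear_combination -h_quad
  have h_lt : g⁻¹ < h⁻¹ := by
    have := pos_of_mul_pos_left (h_inv ▸ mul_pos hα hv) (add_pos hv hu).le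
    linarith
  refine ⟨h_pos, ?_, ?_⟩ <;> nlinarith

/-- Lemma 3 (recursive step size): the sequence defined by `γ_0 = 1` and
`γ_{t+1} = (√(α²γ_t⁴ + 4γ_t²) - αγ_t²)/2` satisfies
`1/(αt+1) ≤ γ_t ≤ 2/(αt+2)` and is nonincreasing. -/
theorem stmt_10 (α : ℝ) (hα0 : 0 < α) (hα1 : α ≤ 1)
    (γ : ℕ → ℝ) (hγ0 : γ 0 = 1)
    (hγrec : ∀ t : ℕ,
      γ (t + 1) = (Real.sqrt (α ^ 2 * (γ t) ^ 4 + 4 * (γ t) ^ 2) - α * (γ t) ^ 2) / 2) :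
    ∀ t : ℕ,
      (1 / (α * (t : ℝ) + 1) ≤ γ t ∧ γ t ≤ 2 / (α * (t : ℝ) + 2)) ∧ γ (t + 1) ≤ γ t := by
  have key : ∀ t : ℕ, 0 < γ t ∧ α * t / 2 + 1 ≤ (γ t)⁻¹ ∧ (γ t)⁻¹ ≤ α * t + 1 := by
    intro t
    induction t with
    | zero => simp [hγ0]
    | succ t ih =>
      obtain ⟨h_pos, h_low, h_up⟩ := ih
      obtain ⟨hs_pos, hs_low, hs_up⟩ := recursive_step_inv_bounds hα0 h_pos (hγrec t)
      push_cast
      exact ⟨hs_pos, by linarith, by linarith⟩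
  intro t
  obtain ⟨h_pos, h_low, h_up⟩ := key t
  obtain ⟨hs_pos, hs_low, -⟩ := recursive_step_inv_bounds hα0 h_pos (hγrec t)
  refine ⟨⟨?_, ?_⟩, (inv_le_inv₀ h_pos hs_pos).1 (by linarith)⟩
  · rw [one_div]
    exact inv_le_of_inv_le₀ h_pos h_up
  · calc γ t ≤ (α * t / 2 + 1)⁻¹ := le_inv_of_le_inv₀ (by positivity) h_low
      _ = 2 / (α * t + 2) := by field_simp
end

section
/- Let α ∈ (0,1] and C ≥ 0 be reals, and define the sequence (γ_t)_{t≥0} by γ_0 = 1 and γ_{t+1} = (√(α² γ_t⁴ + 4 γ_t²) − α γ_t²)/2. Let (h_t)_{t≥0} be a sequence of nonnegative reals satisfying h_{t+1} ≤ (1 − αγ_t) h_t + γ_t² C / 2 for all t ≥ 0. Then for every t ≥ 1, h_t ≤ 4(1 − α) h_0 / (α t + 2 − α)² + 2 t C / (α t + 2 − α)². -/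
/-- The recursive step `(√(α²a⁴ + 4a²) - αa²)/2` is the positive root of `b² = (1 - αb)a²`. -/
theorem step_pos_and_sq {α a b : ℝ} (ha : 0 < a)
    (hb : b = (Real.sqrt (α ^ 2 * a ^ 4 + 4 * a ^ 2) - α * a ^ 2) / 2) :
    0 < b ∧ b ^ 2 = (1 - α * b) * a ^ 2 := by
  have hsq : Real.sqrt (α ^ 2 * a ^ 4 + 4 * a ^ 2) ^ 2 = α ^ 2 * a ^ 4 + 4 * a ^ 2 :=
    Real.sq_sqrt (by positivity)
  have hlt : α * a ^ 2 < Real.sqrt (α ^ 2 * a ^ 4 + 4 * a ^ 2) := by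
    apply Real.lt_sqrt_of_sq_lt
    nlinarith [pow_pos ha 2]
  have hroot : Real.sqrt (α ^ 2 * a ^ 4 + 4 * a ^ 2) = 2 * b + α * a ^ 2 := by linarith
  rw [hroot] at hsq
  exact ⟨by linarith, by linarith⟩

theorem step_le_mul_one_sub_half {α a b : ℝ} (ha : 0 < a) (hb : 0 < b)
    (hab : b ^ 2 = (1 - α * b) * a ^ 2) : b ≤ a * (1 - α * b / 2) := by
  have hpos : 0 < 1 - α * b :=
    pos_of_mul_pos_left (hab ▸ pow_pos hb 2) (sq_nonneg a)
  have hfac : 0 ≤ 1 - α * b / 2 := by linarith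
  refine (sq_le_sq₀ hb.le (mul_nonneg ha.le hfac)).mp ?_
  nlinarith [sq_nonneg (a * (α * b))]

/-- The step sizes are positive and satisfy `γ_t ≤ 2 / (αt + 2)`. -/
theorem stepSize_pos_and_mul_le {α : ℝ} {γ : ℕ → ℝ} (hγ0 : γ 0 = 1)
    (hγrec : ∀ t : ℕ,
      γ (t + 1) = (Real.sqrt (α ^ 2 * (γ t) ^ 4 + 4 * (γ t) ^ 2) - α * (γ t) ^ 2) / 2)
    (hα : 0 ≤ α) (t : ℕ) : 0 < γ t ∧ γ t * (α * t + 2) ≤ 2 := by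
  induction t with
  | zero => simp [hγ0]
  | succ t ih =>
    obtain ⟨hpos, hle⟩ := ih
    obtain ⟨hpos', hsq⟩ := step_pos_and_sq hpos (hγrec t)
    refine ⟨hpos', ?_⟩
    have hstep := step_le_mul_one_sub_half hpos hpos' hsq
    have hfac : 0 ≤ 1 - α * γ (t + 1) / 2 := by
      by_contra! hneg
      linarith [mul_neg_of_pos_of_neg hpos hneg]
    have hs : 0 ≤ α * (t : ℝ) + 2 := by positivity
    have h1 := mul_le_mul_of_nonneg_right hstep hs
    have h2 := mul_le_mul_of_nonneg_right hle hfac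
    push_cast
    linarith

/-- Unrolling the descent recurrence along `γ_{t+1}² = (1 - αγ_{t+1})γ_t²`. -/
theorem le_sq_mul_of_descent {α C : ℝ} {γ h : ℕ → ℝ} (hγ0 : γ 0 = 1)
    (hsq : ∀ t, γ (t + 1) ^ 2 = (1 - α * γ (t + 1)) * γ t ^ 2) (hpos : ∀ t, 0 < γ t)
    (hrec : ∀ t, h (t + 1) ≤ (1 - α * γ t) * h t + (γ t) ^ 2 * C / 2) (t : ℕ) :
    h (t + 1) ≤ γ t ^ 2 * ((1 - α) * h 0 + (t + 1) * C / 2) := by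
  induction t with
  | zero => simpa [hγ0] using hrec 0
  | succ t ih =>
    have hfac : 0 ≤ 1 - α * γ (t + 1) :=
      (pos_of_mul_pos_left (hsq t ▸ pow_pos (hpos (t + 1)) 2) (sq_nonneg (γ t))).le
    calc h (t + 1 + 1) ≤ (1 - α * γ (t + 1)) * h (t + 1) + γ (t + 1) ^ 2 * C / 2 := hrec (t + 1)
      _ ≤ (1 - α * γ (t + 1)) * (γ t ^ 2 * ((1 - α) * h 0 + (t + 1) * C / 2))
          + γ (t + 1) ^ 2 * C / 2 := by gcongr
      _ = γ (t + 1) ^ 2 * ((1 - α) * h 0 + ((t + 1 : ℕ) + 1) * C / 2) := by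
        rw [← mul_assoc, ← hsq t]
        push_cast
        ring

/-- Primal bound of Corollary 2 as a deterministic recurrence: with the recursive
step size `γ_0 = 1`, `γ_{t+1} = (√(α²γ_t⁴ + 4γ_t²) - αγ_t²)/2` and nonnegative `h_t`
with `h_{t+1} ≤ (1 - αγ_t) h_t + γ_t² C/2`, for all `t ≥ 1` one has
`h_t ≤ 4(1-α)h_0/(αt + 2 - α)² + 2tC/(αt + 2 - α)²`. -/
theorem stmt_11 (α C : ℝ) (hα0 : 0 < α) (hα1 : α ≤ 1) (hC : 0 ≤ C)
    (γ : ℕ → ℝ) (hγ0 : γ 0 = 1)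
    (hγrec : ∀ t : ℕ,
      γ (t + 1) = (Real.sqrt (α ^ 2 * (γ t) ^ 4 + 4 * (γ t) ^ 2) - α * (γ t) ^ 2) / 2)
    (h : ℕ → ℝ) (hh : ∀ t, 0 ≤ h t)
    (hrec : ∀ t, h (t + 1) ≤ (1 - α * γ t) * h t + (γ t) ^ 2 * C / 2) :
    ∀ t : ℕ, 1 ≤ t →
      h t ≤ 4 * (1 - α) * h 0 / (α * (t : ℝ) + 2 - α) ^ 2
        + 2 * (t : ℝ) * C / (α * (t : ℝ) + 2 - α) ^ 2 := by
  intro t ht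
  obtain ⟨n, rfl⟩ := Nat.exists_eq_succ_of_ne_zero (Nat.one_le_iff_ne_zero.mp ht)
  have hstep := stepSize_pos_and_mul_le hγ0 hγrec hα0.le
  have hbound := le_sq_mul_of_descent hγ0
    (fun t => (step_pos_and_sq (hstep t).1 (hγrec t)).2) (fun t => (hstep t).1) hrec n
  have hden : 0 < α * (n : ℝ) + 2 := by positivity
  have hγle : γ n ≤ 2 / (α * n + 2) := (le_div_iff₀ hden).mpr (hstep n).2
  have hγpos := (hstep n).1
  have hcoef : 0 ≤ (1 - α) * h 0 + (n + 1) * C / 2 :=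
    add_nonneg (mul_nonneg (sub_nonneg.mpr hα1) (hh 0)) (by positivity)
  have hcast : α * ((n.succ : ℕ) : ℝ) + 2 - α = α * n + 2 := by
    push_cast
    ring
  calc h (n + 1) ≤ γ n ^ 2 * ((1 - α) * h 0 + (n + 1) * C / 2) := hbound
    _ ≤ (2 / (α * n + 2)) ^ 2 * ((1 - α) * h 0 + (n + 1) * C / 2) := by gcongr
    _ = _ := by
      rw [hcast]
      push_cast
      field_simp
      ring
end

section
/- Let α ∈ (0,1] and C ≥ 0 be reals, and define the sequence (γ_t)_{t≥0} by γ_0 = 1 and γ_{t+1} = (√(α² γ_t⁴ + 4 γ_t²) − α γ_t²)/2. Let (h_t)_{t≥0} and (g_t)_{t≥0} be sequences of nonnegative reals satisfying h_k ≤ g_k and α γ_k g_k ≤ h_k − h_{k+1} + γ_k² C / 2 for all k ≥ 0. Then for every t ≥ 1, min_{0 ≤ k ≤ t} g_k ≤ (27(α t + 1)/(2 α³ t³)) · ((t+1) C + 2(1−α) h_0). -/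
/-- One step of the step-size recursion: positivity, and the quadratic equation it solves. -/
theorem stepSize_succ {α x y : ℝ} (hy : 0 < y)
    (hx : x = (Real.sqrt (α ^ 2 * y ^ 4 + 4 * y ^ 2) - α * y ^ 2) / 2) :
    0 < x ∧ x ^ 2 = y ^ 2 * (1 - α * x) := by
  have hr : 0 ≤ α ^ 2 * y ^ 4 + 4 * y ^ 2 := by positivity
  have hsq := Real.sq_sqrt hr
  have hlt : α * y ^ 2 < Real.sqrt (α ^ 2 * y ^ 4 + 4 * y ^ 2) := by
    apply Real.lt_sqrt_of_sq_lt
    nlinarith [pow_pos hy 2]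
  refine ⟨by rw [hx]; linarith, ?_⟩
  have hs : Real.sqrt (α ^ 2 * y ^ 4 + 4 * y ^ 2) = 2 * x + α * y ^ 2 := by linarith
  rw [hs] at hsq
  linarith

theorem stepSize_succ_le {α x y : ℝ} (hα : 0 < α) (hx : 0 < x) (hy : 0 < y)
    (hxy : x ^ 2 = y ^ 2 * (1 - α * x)) : x ≤ y := by
  have : x ^ 2 ≤ y ^ 2 := by nlinarith [mul_pos (mul_pos hα hx) (pow_pos hy 2)]
  exact (sq_le_sq₀ hx.le hy.le).mp this

/-- The reciprocal of the step size grows by at most `α` and at least `α / 2`. -/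
theorem stepSize_sub_bounds {α x y : ℝ} (hα : 0 < α) (hx : 0 < x) (hy : 0 < y)
    (hxy : x ^ 2 = y ^ 2 * (1 - α * x)) :
    y - x ≤ α * x * y ∧ α * x * y ≤ 2 * (y - x) := by
  have hle := stepSize_succ_le hα hx hy hxy
  have hpos : 0 < α * x * y := by positivity
  constructor
  · refine le_of_mul_le_mul_right ?_ (add_pos hy hx)
    nlinarith [mul_pos hpos hx]
  · refine le_of_mul_le_mul_right ?_ hy
    nlinarith [mul_nonneg (sub_nonneg.2 hle) (sub_nonneg.2 hle)]

section StepSize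

variable {α : ℝ} {γ : ℕ → ℝ}

theorem stepSize_lower (hα : 0 < α) (hγ0 : γ 0 = 1) (hpos : ∀ t, 0 < γ t)
    (hsq : ∀ t, γ (t + 1) ^ 2 = γ t ^ 2 * (1 - α * γ (t + 1))) (t : ℕ) :
    1 ≤ γ t * (1 + α * t) := by
  induction t with
  | zero => simp [hγ0]
  | succ t ih =>
    have hb := (stepSize_sub_bounds hα (hpos (t + 1)) (hpos t) (hsq t)).1
    refine le_of_mul_le_mul_right ?_ (hpos t)
    push_cast
    nlinarith [mul_le_mul_of_nonneg_left ih (hpos (t + 1)).le]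

theorem stepSize_upper (hα : 0 < α) (hγ0 : γ 0 = 1) (hpos : ∀ t, 0 < γ t)
    (hsq : ∀ t, γ (t + 1) ^ 2 = γ t ^ 2 * (1 - α * γ (t + 1))) (t : ℕ) :
    γ t * (2 + α * t) ≤ 2 := by
  induction t with
  | zero => simp [hγ0]
  | succ t ih =>
    have hb := (stepSize_sub_bounds hα (hpos (t + 1)) (hpos t) (hsq t)).2
    refine le_of_mul_le_mul_right ?_ (hpos t)
    push_cast
    nlinarith [mul_le_mul_of_nonneg_left ih (hpos (t + 1)).le]

variable {C : ℝ} {h g : ℕ → ℝ}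

theorem primal_bound_s12 (hα : 0 < α) (hγ0 : γ 0 = 1) (hpos : ∀ t, 0 < γ t)
    (hsq : ∀ t, γ (t + 1) ^ 2 = γ t ^ 2 * (1 - α * γ (t + 1)))
    (hhg : ∀ k, h k ≤ g k)
    (hrec : ∀ k, α * γ k * g k ≤ h k - h (k + 1) + γ k ^ 2 * C / 2) (m : ℕ) :
    h (m + 1) ≤ γ m ^ 2 * (2 * (1 - α) * h 0 + (m + 1) * C) / 2 := by
  have hstep (k : ℕ) : h (k + 1) ≤ (1 - α * γ k) * h k + γ k ^ 2 * C / 2 := by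
    nlinarith [hrec k, mul_le_mul_of_nonneg_left (hhg k) (mul_pos hα (hpos k)).le]
  induction m with
  | zero =>
    have := hstep 0
    rw [hγ0] at this ⊢
    push_cast
    linarith
  | succ m ih =>
    have hnn : 0 ≤ 1 - α * γ (m + 1) := by
      by_contra! hneg
      nlinarith [hsq m, pow_pos (hpos m) 2, pow_pos (hpos (m + 1)) 2]
    calc h (m + 1 + 1)
        ≤ (1 - α * γ (m + 1)) * h (m + 1) + γ (m + 1) ^ 2 * C / 2 := hstep _
      _ ≤ (1 - α * γ (m + 1)) * (γ m ^ 2 * (2 * (1 - α) * h 0 + (m + 1) * C) / 2)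
            + γ (m + 1) ^ 2 * C / 2 := by gcongr
      _ = γ (m + 1) ^ 2 * (2 * (1 - α) * h 0 + ((m + 1 : ℕ) + 1) * C) / 2 := by
        rw [hsq m]; push_cast; ring

/-- Summing the descent inequality over the indices `m + 1, …, m + n`, where the gap is at
least `G`. -/
theorem sum_gap_bound (hα : 0 < α) (hC : 0 ≤ C) (hγ : Antitone γ) (hpos : ∀ t, 0 < γ t)
    {t m : ℕ} {A G : ℝ} (hG : ∀ k ≤ t, G ≤ g k) (hg : ∀ k, 0 ≤ g k)
    (hlow : ∀ k, 1 ≤ γ k * (1 + α * k))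
    (hrec : ∀ k, α * γ k * g k ≤ h k - h (k + 1) + γ k ^ 2 * C / 2)
    (hm : h (m + 1) ≤ γ m ^ 2 * (A + (m + 1) * C) / 2) (n : ℕ) (hn : m + n ≤ t) :
    n * (α * G / (1 + α * t)) + h (m + n + 1) ≤ γ m ^ 2 * (A + (m + n + 1) * C) / 2 := by
  induction n with
  | zero => simpa using hm
  | succ n ih =>
    have ih := ih (by omega)
    have hr := hrec (m + n + 1)
    have hsq : γ (m + n + 1) ^ 2 * C ≤ γ m ^ 2 * C := by
      have := (hpos (m + n + 1)).le
      have := hγ (show m ≤ m + n + 1 by omega)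
      gcongr
    have hden : 0 < 1 + α * (t : ℝ) := by positivity
    have hl : 1 ≤ γ (m + n + 1) * (1 + α * t) := by
      refine (hlow (m + n + 1)).trans ?_
      have := (hpos (m + n + 1)).le
      gcongr
      omega
    have hgap : α * G / (1 + α * t) ≤ α * γ (m + n + 1) * g (m + n + 1) := by
      rw [div_le_iff₀ hden]
      calc α * G ≤ α * g (m + n + 1) := by
            gcongr
            exact hG _ (by omega)
        _ ≤ α * g (m + n + 1) * (γ (m + n + 1) * (1 + α * t)) :=
            le_mul_of_one_le_right (mul_nonneg hα.le (hg _)) hl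
        _ = α * γ (m + n + 1) * g (m + n + 1) * (1 + α * t) := by ring
    rw [show m + (n + 1) + 1 = m + n + 1 + 1 by ring]
    push_cast
    linarith

end StepSize

/-- Duality-gap bound of Corollary 2 as a deterministic recurrence: with the
recursive step size `γ_0 = 1`, `γ_{t+1} = (√(α²γ_t⁴ + 4γ_t²) - αγ_t²)/2` and
nonnegative sequences `h, g` satisfying `h_k ≤ g_k` and
`α γ_k g_k ≤ h_k - h_{k+1} + γ_k² C/2`, for all `t ≥ 1`,
`min_{0≤k≤t} g_k ≤ (27(αt+1)/(2α³t³)) ((t+1)C + 2(1-α)h_0)`. -/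
theorem stmt_12 (α C : ℝ) (hα0 : 0 < α) (hα1 : α ≤ 1) (hC : 0 ≤ C)
    (γ : ℕ → ℝ) (hγ0 : γ 0 = 1)
    (hγrec : ∀ t : ℕ,
      γ (t + 1) = (Real.sqrt (α ^ 2 * (γ t) ^ 4 + 4 * (γ t) ^ 2) - α * (γ t) ^ 2) / 2)
    (h g : ℕ → ℝ) (hh : ∀ t, 0 ≤ h t) (hg : ∀ t, 0 ≤ g t)
    (hhg : ∀ k, h k ≤ g k)
    (hrec : ∀ k, α * γ k * g k ≤ h k - h (k + 1) + (γ k) ^ 2 * C / 2) :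
    ∀ t : ℕ, 1 ≤ t →
      (Finset.range (t + 1)).inf' (Finset.nonempty_range_iff.mpr (Nat.succ_ne_zero t)) g
        ≤ 27 * (α * (t : ℝ) + 1) / (2 * α ^ 3 * (t : ℝ) ^ 3)
          * (((t : ℝ) + 1) * C + 2 * (1 - α) * h 0) := by
  have hpos (t : ℕ) : 0 < γ t := by
    induction t with
    | zero => simp [hγ0]
    | succ t ih => exact (stepSize_succ ih (hγrec t)).1
  have hsq (t : ℕ) : γ (t + 1) ^ 2 = γ t ^ 2 * (1 - α * γ (t + 1)) :=
    (stepSize_succ (hpos t) (hγrec t)).2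
  have hanti : Antitone γ :=
    antitone_nat_of_succ_le fun t => stepSize_succ_le hα0 (hpos _) (hpos _) (hsq t)
  intro t ht
  set G := (Finset.range (t + 1)).inf' (Finset.nonempty_range_iff.mpr (Nat.succ_ne_zero t)) g
    with hGdef
  have hG : ∀ k ≤ t, G ≤ g k := fun k hk =>
    Finset.inf'_le g (Finset.mem_range.2 (Nat.lt_succ_of_le hk))
  have hG0 : 0 ≤ G := Finset.le_inf' _ _ fun k _ => hg k
  obtain ⟨m, n, hmn, hm, hn⟩ : ∃ m n : ℕ, m + n = t ∧ 2 * t ≤ 3 * (m + 1) ∧ t ≤ 3 * n :=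
    ⟨t - t / 3 - 1, t / 3 + 1, by omega, by omega, by omega⟩
  have key := sum_gap_bound hα0 hC hanti hpos hG hg (stepSize_lower hα0 hγ0 hpos hsq) hrec
    (primal_bound_s12 hα0 hγ0 hpos hsq hhg hrec m) n hmn.le
  have hupper := stepSize_upper hα0 hγ0 hpos hsq m
  have ht0 : (0 : ℝ) < t := by exact_mod_cast ht
  have hm' : 2 * (t : ℝ) ≤ 3 * (m + 1) := by exact_mod_cast hm
  have hn' : (t : ℝ) ≤ 3 * n := by exact_mod_cast hn
  have hcast : (m : ℝ) + n = t := by exact_mod_cast hmn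
  rw [hcast] at key
  have hD : 0 ≤ (t + 1) * C + 2 * (1 - α) * h 0 := by
    have := hh 0
    have : 0 ≤ 1 - α := by linarith
    positivity
  set D := (t + 1) * C + 2 * (1 - α) * h 0 with hDdef
  have hγm : γ m ≤ 3 / (α * t) := by
    rw [le_div_iff₀ (by positivity)]
    have : α * t * 2 ≤ 3 * (2 + α * m) := by nlinarith
    nlinarith [mul_le_mul_of_nonneg_left this (hpos m).le]
  have hden : 0 < 1 + α * (t : ℝ) := by positivity
  have hmain : t / 3 * (α * G / (1 + α * t)) ≤ (3 / (α * t)) ^ 2 * D / 2 := by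
    calc t / 3 * (α * G / (1 + α * t)) ≤ n * (α * G / (1 + α * t)) := by
          gcongr
          linarith
      _ ≤ γ m ^ 2 * D / 2 := by
          have := hh (m + n + 1)
          rw [hDdef]
          linarith
      _ ≤ (3 / (α * t)) ^ 2 * D / 2 := by
          have := (hpos m).le
          gcongr
  calc G = t / 3 * (α * G / (1 + α * t)) * (3 * (1 + α * t) / (α * t)) := by
        field_simp
    _ ≤ (3 / (α * t)) ^ 2 * D / 2 * (3 * (1 + α * t) / (α * t)) := by gcongr
    _ = 27 * (α * t + 1) / (2 * α ^ 3 * t ^ 3) * D := by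
        field_simp
        ring
end

section
/- Let α ∈ (0,1] and C ≥ 0 be reals, let (γ_t)_{t≥0} be a real sequence with 0 ≤ γ_t ≤ 1 for all t, and let (h_t)_{t≥0} and (g_t)_{t≥0} be sequences of nonnegative reals satisfying α γ_k g_k ≤ h_k − h_{k+1} + γ_k² C / 2 for all k ≥ 0. Then for every t ≥ 0 with ∑_{k=0}^t γ_k > 0, min_{0 ≤ k ≤ t} g_k ≤ h_0 / (α ∑_{k=0}^t γ_k) + C (∑_{k=0}^t γ_k²) / (2 α ∑_{k=0}^t γ_k). -/
/-- The minimum of `g` weighted by nonnegative weights `w` is at most the weighted sum of `g`. -/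
theorem Finset.inf'_mul_sum_le_sum_mul {ι : Type*} (s : Finset ι) (hs : s.Nonempty)
    (w g : ι → ℝ) (hw : ∀ i ∈ s, 0 ≤ w i) :
    s.inf' hs g * ∑ i ∈ s, w i ≤ ∑ i ∈ s, w i * g i := by
  rw [Finset.mul_sum]
  refine Finset.sum_le_sum fun i hi => ?_
  rw [mul_comm]
  exact mul_le_mul_of_nonneg_left (Finset.inf'_le g hi) (hw i hi)

/-- Telescoped form of the descent inequality. -/
theorem mul_sum_le_of_descent {α C : ℝ} {γ h g : ℕ → ℝ}
    (hrec : ∀ k, α * γ k * g k ≤ h k - h (k + 1) + (γ k) ^ 2 * C / 2) (n : ℕ) :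
    α * ∑ k ∈ Finset.range n, γ k * g k
      ≤ h 0 - h n + C / 2 * ∑ k ∈ Finset.range n, (γ k) ^ 2 := by
  induction n with
  | zero => simp
  | succ n ih =>
    rw [Finset.sum_range_succ, Finset.sum_range_succ]
    linarith [hrec n]

/-- Theorem 3 (nonconvex convergence) as a deterministic recurrence: for any step
sizes `γ_t ∈ [0,1]` and nonnegative sequences `h, g` with
`α γ_k g_k ≤ h_k - h_{k+1} + γ_k² C/2`, whenever `∑_{k=0}^t γ_k > 0`,
`min_{0≤k≤t} g_k ≤ h_0/(α ∑_{k=0}^t γ_k) + C (∑_{k=0}^t γ_k²)/(2α ∑_{k=0}^t γ_k)`. -/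
theorem stmt_13 (α C : ℝ) (hα0 : 0 < α) (hα1 : α ≤ 1) (hC : 0 ≤ C)
    (γ h g : ℕ → ℝ) (hγ0 : ∀ t, 0 ≤ γ t) (hγ1 : ∀ t, γ t ≤ 1)
    (hh : ∀ t, 0 ≤ h t) (hg : ∀ t, 0 ≤ g t)
    (hrec : ∀ k, α * γ k * g k ≤ h k - h (k + 1) + (γ k) ^ 2 * C / 2) :
    ∀ t : ℕ, 0 < ∑ k ∈ Finset.range (t + 1), γ k →
      (Finset.range (t + 1)).inf' (Finset.nonempty_range_iff.mpr (Nat.succ_ne_zero t)) g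
        ≤ h 0 / (α * ∑ k ∈ Finset.range (t + 1), γ k)
          + C * (∑ k ∈ Finset.range (t + 1), (γ k) ^ 2)
            / (2 * α * ∑ k ∈ Finset.range (t + 1), γ k) := by
  intro t hS
  have hmin := Finset.inf'_mul_sum_le_sum_mul (Finset.range (t + 1))
    (Finset.nonempty_range_iff.mpr (Nat.succ_ne_zero t)) γ g fun k _ => hγ0 k
  have hsum := mul_sum_le_of_descent hrec (t + 1)
  have hbound : h 0 / (α * ∑ k ∈ Finset.range (t + 1), γ k)
      + C * (∑ k ∈ Finset.range (t + 1), (γ k) ^ 2)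
        / (2 * α * ∑ k ∈ Finset.range (t + 1), γ k)
      = (h 0 + C / 2 * ∑ k ∈ Finset.range (t + 1), (γ k) ^ 2)
        / (α * ∑ k ∈ Finset.range (t + 1), γ k) := by
    field_simp
  rw [hbound, le_div_iff₀ (mul_pos hα0 hS)]
  linarith [mul_le_mul_of_nonneg_left hmin hα0.le, hh (t + 1)]
end

section
/- Let α ∈ (0,1] and C > 0 be reals, and let (h_t)_{t≥0} and (g_t)_{t≥0} be sequences of nonnegative reals satisfying min{α g_k / 2, α² g_k² / (2C)} ≤ h_k − h_{k+1} for all k ≥ 0. Then for every t ≥ 0, min_{0 ≤ k ≤ t} g_k ≤ max{2 h_0 / (α (t+1)), √(2 C h_0) / (α √(t+1))}, and consequently min_{0 ≤ k ≤ t} g_k ≤ max{2 h_0, C} / (α √(t+1)). -/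
/-- Telescoping: a nonnegative sequence that decreases by at least `c` at each of its first `n`
steps satisfies `n * c ≤ h 0`. -/
theorem nat_mul_le_of_le_sub_succ {h : ℕ → ℝ} {c : ℝ} {n : ℕ} (hn : 0 ≤ h n)
    (hc : ∀ k < n, c ≤ h k - h (k + 1)) : (n : ℝ) * c ≤ h 0 := by
  have hsum : ∑ _k ∈ Finset.range n, c ≤ ∑ k ∈ Finset.range n, (h k - h (k + 1)) :=
    Finset.sum_le_sum fun k hk => hc k (Finset.mem_range.mp hk)
  rw [Finset.sum_range_sub', Finset.sum_const, Finset.card_range, nsmul_eq_mul] at hsum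
  linarith

theorem sqrt_mul_le_max {a b : ℝ} (ha : 0 ≤ a) (hb : 0 ≤ b) : Real.sqrt (a * b) ≤ max a b := by
  refine Real.sqrt_le_iff.mpr ⟨le_max_of_le_left ha, ?_⟩
  rw [sq]
  exact mul_le_mul (le_max_left a b) (le_max_right a b) hb (le_max_of_le_left ha)

/-- Inverting `s * min (α * m / 2) (α ^ 2 * m ^ 2 / (2 * C)) ≤ H` for `m`. -/
theorem le_max_of_mul_min_le {α C s m H : ℝ} (hα : 0 < α) (hC : 0 < C) (hs : 0 < s)
    (hH : s * min (α * m / 2) (α ^ 2 * m ^ 2 / (2 * C)) ≤ H) :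
    m ≤ max (2 * H / (α * s)) (Real.sqrt (2 * C * H) / (α * Real.sqrt s)) := by
  rcases min_choice (α * m / 2) (α ^ 2 * m ^ 2 / (2 * C)) with hmin | hmin <;> rw [hmin] at hH
  · refine le_max_of_le_left ?_
    rw [le_div_iff₀ (by positivity)]
    linarith
  · refine le_max_of_le_right ?_
    rw [le_div_iff₀ (by positivity)]
    refine Real.le_sqrt_of_sq_le ?_
    rw [mul_pow, mul_pow, Real.sq_sqrt hs.le]
    rw [← mul_div_assoc, div_le_iff₀ (by positivity)] at hH
    linarith

theorem max_div_le_max_div_sqrt {α C s H : ℝ} (hα : 0 < α) (hC : 0 ≤ C) (hs : 1 ≤ s)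
    (hH : 0 ≤ H) :
    max (2 * H / (α * s)) (Real.sqrt (2 * C * H) / (α * Real.sqrt s))
      ≤ max (2 * H) C / (α * Real.sqrt s) := by
  have hs0 : 0 < s := by linarith
  refine max_le ?_ ?_
  · have hsqrt : Real.sqrt s ≤ s := Real.sqrt_le_iff.mpr ⟨hs0.le, by nlinarith⟩
    gcongr
    exact le_max_left _ _
  · gcongr
    rw [mul_right_comm]
    exact sqrt_mul_le_max (by positivity) hC

/-- Theorem 4 (nonconvex convergence with exact line search) as a deterministic
recurrence: if `min{αg_k/2, α²g_k²/(2C)} ≤ h_k - h_{k+1}` for all `k`, then for all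
`t ≥ 0`, `min_{0≤k≤t} g_k ≤ max{2h_0/(α(t+1)), √(2Ch_0)/(α√(t+1))}`, and hence
`min_{0≤k≤t} g_k ≤ max{2h_0, C}/(α√(t+1))`. -/
theorem stmt_18 (α C : ℝ) (hα0 : 0 < α) (hα1 : α ≤ 1) (hC : 0 < C)
    (h g : ℕ → ℝ) (hh : ∀ t, 0 ≤ h t) (hg : ∀ t, 0 ≤ g t)
    (hrec : ∀ k, min (α * g k / 2) (α ^ 2 * (g k) ^ 2 / (2 * C)) ≤ h k - h (k + 1)) :
    ∀ t : ℕ,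
      (Finset.range (t + 1)).inf' (Finset.nonempty_range_iff.mpr (Nat.succ_ne_zero t)) g
          ≤ max (2 * h 0 / (α * ((t : ℝ) + 1)))
              (Real.sqrt (2 * C * h 0) / (α * Real.sqrt ((t : ℝ) + 1)))
        ∧ (Finset.range (t + 1)).inf' (Finset.nonempty_range_iff.mpr (Nat.succ_ne_zero t)) g
          ≤ max (2 * h 0) C / (α * Real.sqrt ((t : ℝ) + 1)) := by
  intro t
  set m := (Finset.range (t + 1)).inf' (Finset.nonempty_range_iff.mpr (Nat.succ_ne_zero t)) g
  have hm0 : 0 ≤ m := Finset.le_inf' _ _ fun k _ => hg k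
  have hstep : ∀ k < t + 1,
      min (α * m / 2) (α ^ 2 * m ^ 2 / (2 * C)) ≤ h k - h (k + 1) := by
    intro k hk
    have hmk : m ≤ g k := Finset.inf'_le g (Finset.mem_range.mpr hk)
    refine le_trans ?_ (hrec k)
    gcongr
  have hsum := nat_mul_le_of_le_sub_succ (hh (t + 1)) hstep
  push_cast at hsum
  have hs : (1 : ℝ) ≤ (t : ℝ) + 1 := by linarith [Nat.cast_nonneg (α := ℝ) t]
  have hbound := le_max_of_mul_min_le hα0 hC (by linarith) hsum
  exact ⟨hbound, hbound.trans (max_div_le_max_div_sqrt hα0 hC.le hs (hh 0))⟩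
end

section
/- Let q ∈ (0,1] and ρ ∈ (1/2, 1] be reals, define γ_k := 2/(q k^ρ + 2) for integers k ≥ 0, and for an integer t ≥ 1 set K := ⌈(2ρ/(2ρ+1)) · t⌉. Then 1 ≤ K ≤ t and γ_{K−1}² / (t − K + 1) ≤ 4 (2ρ+1)^{2ρ+1} / (q² (2ρ)^{2ρ} t^{2ρ+1}). -/
/-- Technical bound in the proof of Corollary 1: for `γ_k = 2/(q k^ρ + 2)`,
`t ≥ 1`, and `K = ⌈(2ρ/(2ρ+1)) t⌉`, one has `1 ≤ K ≤ t` and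
`γ_{K-1}²/(t - K + 1) ≤ 4(2ρ+1)^{2ρ+1}/(q²(2ρ)^{2ρ} t^{2ρ+1})`. -/
theorem stmt_19 (q ρ : ℝ) (hq0 : 0 < q) (hq1 : q ≤ 1) (hρ0 : 1 / 2 < ρ) (hρ1 : ρ ≤ 1)
    (γ : ℕ → ℝ) (hγ : ∀ k : ℕ, γ k = 2 / (q * (k : ℝ) ^ ρ + 2))
    (t : ℕ) (ht : 1 ≤ t) (K : ℕ) (hK : K = ⌈(2 * ρ / (2 * ρ + 1)) * (t : ℝ)⌉₊) :
    1 ≤ K ∧ K ≤ t ∧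
      (γ (K - 1)) ^ 2 / ((t : ℝ) - (K : ℝ) + 1)
        ≤ 4 * (2 * ρ + 1) ^ (2 * ρ + 1)
          / (q ^ 2 * (2 * ρ) ^ (2 * ρ) * (t : ℝ) ^ (2 * ρ + 1)) := by
  have hρ : 0 < ρ := by linarith
  have ht0 : (0 : ℝ) < t := by exact_mod_cast ht
  set a : ℝ := (2 * ρ / (2 * ρ + 1)) * (t : ℝ) with ha
  have ha0 : 0 < a := by positivity
  have hab : (t : ℝ) - a = t / (2 * ρ + 1) := by
    rw [ha]; field_simp; ring
  have hb0 : 0 < (t : ℝ) / (2 * ρ + 1) := by positivity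
  have hK1 : 1 ≤ K := by
    rw [hK]; exact Nat.ceil_pos.mpr ha0
  have hKt : K ≤ t := by
    rw [hK]; exact Nat.ceil_le.mpr (by linarith)
  have haK : a ≤ K := by rw [hK]; exact Nat.le_ceil a
  have hKa : (K : ℝ) < a + 1 := by rw [hK]; exact Nat.ceil_lt_add_one ha0.le
  refine ⟨hK1, hKt, ?_⟩
  have hsub : (K : ℝ) ^ ρ ≤ ((K - 1 : ℕ) : ℝ) ^ ρ + 1 := by
    have h := Real.rpow_add_le_add_rpow (Nat.cast_nonneg (K - 1)) zero_le_one hρ.le hρ1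
    rw [Real.one_rpow] at h
    rwa [← Nat.cast_add_one, Nat.sub_add_cancel hK1] at h
  have hden : q * a ^ ρ ≤ q * ((K - 1 : ℕ) : ℝ) ^ ρ + 2 := by
    have h := mul_le_mul_of_nonneg_left
      ((Real.rpow_le_rpow ha0.le haK hρ.le).trans hsub) hq0.le
    linarith
  have hγK : γ (K - 1) ≤ 2 / (q * a ^ ρ) := by
    rw [hγ]; gcongr
  have hγ0 : 0 ≤ γ (K - 1) := by
    rw [hγ]; positivity
  calc (γ (K - 1)) ^ 2 / ((t : ℝ) - (K : ℝ) + 1)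
      ≤ (2 / (q * a ^ ρ)) ^ 2 / (t / (2 * ρ + 1)) := by
        gcongr
        linarith
    _ = _ := by
        have hpow : (a ^ ρ) ^ 2 = (2 * ρ) ^ (2 * ρ) / (2 * ρ + 1) ^ (2 * ρ) * (t : ℝ) ^ (2 * ρ) := by
          rw [← Real.rpow_mul_natCast ha0.le, ha, Real.mul_rpow (by positivity) ht0.le,
            Real.div_rpow (by positivity) (by positivity)]
          push_cast
          rw [mul_comm ρ 2]
        rw [div_pow, mul_pow, hpow, Real.rpow_add_one (by positivity),
          Real.rpow_add_one ht0.ne']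
        have h1 : (0 : ℝ) < (2 * ρ) ^ (2 * ρ) := by positivity
        have h2 : (0 : ℝ) < (2 * ρ + 1) ^ (2 * ρ) := by positivity
        have h3 : (0 : ℝ) < (t : ℝ) ^ (2 * ρ) := by positivity
        generalize (2 * ρ) ^ (2 * ρ) = x at *
        generalize (2 * ρ + 1) ^ (2 * ρ) = y at *
        generalize (t : ℝ) ^ (2 * ρ) = z at *
        field_simp
        norm_num
end
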